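/- For the single-resource multi-stage LP on a scenario tree 𝒯, its optimal value v^M satisfies a_* δ̄ ≤ v^M ≤ a^* δ̄, where a_* = min_{n∈𝒯} a_n, a^* = max_{n∈𝒯} a_n, and δ̄ = Σ_{n∈S_T} p_n max_{m∈P(n)} δ_m. -/

import Mathlib

open scoped Classical

noncomputable section

/-- A scenario tree with `T` stages over a finite node type: a finite rooted tree whose
nodes are partitioned into stages `1, …, T` (the root being the unique stage-1 node),
equipped with strictly positive node probabilities summing to one within each stage and
with each internal node's probability equal to the sum of its children's probabilities. -/
structure ScenarioTree (T : ℕ) (Node : Type) [Fintype Node] [DecidableEq Node] where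
  root : Node
  parent : Node → Node
  stage : Node → ℕ
  stage_root : stage root = 1
  stage_pos : ∀ n, 1 ≤ stage n
  stage_le : ∀ n, stage n ≤ T
  root_unique : ∀ n, stage n = 1 → n = root
  parent_root : parent root = root
  parent_stage : ∀ n, n ≠ root → stage (parent n) + 1 = stage n
  reaches_root : ∀ n, ∃ k : ℕ, parent^[k] n = root
  prob : Node → ℝ
  prob_pos : ∀ n, 0 < prob n
  prob_sum_stage : ∀ t, 1 ≤ t → t ≤ T →
    ∑ n ∈ Finset.univ.filter (fun n => stage n = t), prob n = 1
  prob_children : ∀ n, stage n < T →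
    prob n = ∑ m ∈ Finset.univ.filter (fun m => m ≠ root ∧ parent m = n), prob m

namespace ScenarioTree

variable {T : ℕ} {Node : Type} [Fintype Node] [DecidableEq Node]

/-- `m` lies on the unique path from the root to `n` (i.e. `m` is an ancestor of `n`
or `n` itself); equivalently, `n` belongs to the subtree `𝒯(m)` rooted at `m`. -/
def onPath (tr : ScenarioTree T Node) (m n : Node) : Prop :=
  ∃ k : ℕ, tr.parent^[k] n = m

/-- `P(n)`: the set of nodes on the unique path from the root to `n` (inclusive). -/
def pathSet (tr : ScenarioTree T Node) (n : Node) : Finset Node :=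
  Finset.univ.filter fun m => tr.onPath m n

/-- `S_t`: the set of nodes in stage `t`. -/
def stageSet (tr : ScenarioTree T Node) (t : ℕ) : Finset Node :=
  Finset.univ.filter fun n => tr.stage n = t

/-- Objective `∑_{n ∈ 𝒯} p_n a_n x_n` of the single-resource capacity expansion LP. -/
def lpObj (tr : ScenarioTree T Node) (a x : Node → ℝ) : ℝ :=
  ∑ n, tr.prob n * a n * x n

/-- Feasibility for the single-resource capacity expansion LP:
`x ≥ 0` and `∑_{m ∈ P(n)} x_m ≥ δ_n` for all nodes `n`. -/
def lpFeas (tr : ScenarioTree T Node) (δ x : Node → ℝ) : Prop :=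
  (∀ n, 0 ≤ x n) ∧ ∀ n, δ n ≤ ∑ m ∈ tr.pathSet n, x m

/-- Two-stage constraint: `x_m = x_n` for all `m, n` in the same stage. -/
def twoStageConstr (tr : ScenarioTree T Node) (x : Node → ℝ) : Prop :=
  ∀ m n, tr.stage m = tr.stage n → x m = x n

/-- Adaptive two-stage constraint with revision time `t*`: `x_m = x_n` for all
`m, n ∈ S_t` with `t < t*`, and `x_m = x_n` for all `m, n ∈ S_t ∩ 𝒯(j)` for each
`j ∈ S_{t*}` and each `t ≥ t*`. -/
def adaptiveConstr (tr : ScenarioTree T Node) (tstar : ℕ) (x : Node → ℝ) : Prop :=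
  (∀ m n, tr.stage m = tr.stage n → tr.stage m < tstar → x m = x n) ∧
  (∀ j, tr.stage j = tstar → ∀ m n, tr.onPath j m → tr.onPath j n →
    tr.stage m = tr.stage n → x m = x n)

/-- `v^M`: optimal value of the multi-stage LP. -/
def vM (tr : ScenarioTree T Node) (a δ : Node → ℝ) : ℝ :=
  sInf (tr.lpObj a '' {x | tr.lpFeas δ x})

/-- `v^T`: optimal value of the two-stage LP. -/
def vT (tr : ScenarioTree T Node) (a δ : Node → ℝ) : ℝ :=
  sInf (tr.lpObj a '' {x | tr.lpFeas δ x ∧ tr.twoStageConstr x})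

/-- `v^R(t*)`: optimal value of the adaptive two-stage LP with revision time `t*`. -/
def vR (tr : ScenarioTree T Node) (a δ : Node → ℝ) (tstar : ℕ) : ℝ :=
  sInf (tr.lpObj a '' {x | tr.lpFeas δ x ∧ tr.adaptiveConstr tstar x})

/-- `a_* = min_{n∈𝒯} a_n`. -/
def aMin (tr : ScenarioTree T Node) (a : Node → ℝ) : ℝ := sInf (Set.range a)

/-- `a^* = max_{n∈𝒯} a_n`. -/
def aMax (tr : ScenarioTree T Node) (a : Node → ℝ) : ℝ := sSup (Set.range a)

/-- `δ* = max_{n∈𝒯} δ_n`. -/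
def deltaMax (tr : ScenarioTree T Node) (δ : Node → ℝ) : ℝ := sSup (Set.range δ)

/-- `a̲^−(t*) = min{a_n : t_n < t*}`. -/
def aMinusLo (tr : ScenarioTree T Node) (a : Node → ℝ) (tstar : ℕ) : ℝ :=
  sInf (a '' {n | tr.stage n < tstar})

/-- `a̲^+(t*) = min{a_n : t_n ≥ t*}`. -/
def aPlusLo (tr : ScenarioTree T Node) (a : Node → ℝ) (tstar : ℕ) : ℝ :=
  sInf (a '' {n | tstar ≤ tr.stage n})

/-- `ā^−(t*) = max{a_n : t_n < t*}`. -/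
def aMinusHi (tr : ScenarioTree T Node) (a : Node → ℝ) (tstar : ℕ) : ℝ :=
  sSup (a '' {n | tr.stage n < tstar})

/-- `ā^+(t*) = max{a_n : t_n ≥ t*}`. -/
def aPlusHi (tr : ScenarioTree T Node) (a : Node → ℝ) (tstar : ℕ) : ℝ :=
  sSup (a '' {n | tstar ≤ tr.stage n})

/-- `δ^−(t*) = max_{m ∈ 𝒯(1, t*−1)} δ_m`, the maximum demand before the revision time. -/
def deltaMinus (tr : ScenarioTree T Node) (δ : Node → ℝ) (tstar : ℕ) : ℝ :=
  sSup (δ '' {m | tr.stage m < tstar})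

/-- `δ^+(t*) = ∑_{n ∈ S_{t*}} p_n · max_{m ∈ 𝒯(1, t*−1) ∪ 𝒯(n)} δ_m`. -/
def deltaPlus (tr : ScenarioTree T Node) (δ : Node → ℝ) (tstar : ℕ) : ℝ :=
  ∑ n ∈ tr.stageSet tstar, tr.prob n *
    sSup (δ '' {m | tr.stage m < tstar ∨ tr.onPath n m})

/-- `δ̄ = ∑_{n ∈ S_T} p_n · max_{m ∈ P(n)} δ_m`, the expected maximum demand over scenarios. -/
def deltaBar (tr : ScenarioTree T Node) (δ : Node → ℝ) : ℝ :=
  ∑ n ∈ tr.stageSet T, tr.prob n * sSup (δ '' {m | tr.onPath m n})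

end ScenarioTree


namespace ScenarioTree

variable {T : ℕ} {Node : Type} [Fintype Node] [DecidableEq Node]

lemma onPath_self (tr : ScenarioTree T Node) (n : Node) : tr.onPath n n := ⟨0, rfl⟩

lemma onPath_parent (tr : ScenarioTree T Node) {m n : Node} (h : tr.onPath m (tr.parent n)) :
    tr.onPath m n := by
  obtain ⟨k, hk⟩ := h
  exact ⟨k + 1, by rw [Function.iterate_succ_apply]; exact hk⟩

lemma onPath_iff (tr : ScenarioTree T Node) (m n : Node) :
    tr.onPath m n ↔ m = n ∨ tr.onPath m (tr.parent n) := by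
  constructor
  · rintro ⟨k, hk⟩
    cases k with
    | zero => exact Or.inl hk.symm
    | succ k => exact Or.inr ⟨k, by rw [Function.iterate_succ_apply] at hk; exact hk⟩
  · rintro (rfl | h)
    · exact tr.onPath_self _
    · exact tr.onPath_parent h

lemma onPath_trans (tr : ScenarioTree T Node) {l m n : Node} (h : tr.onPath l m)
    (h' : tr.onPath m n) : tr.onPath l n := by
  obtain ⟨k, rfl⟩ := h
  obtain ⟨j, rfl⟩ := h'
  exact ⟨k + j, Function.iterate_add_apply _ _ _ _⟩

lemma stage_parent_le (tr : ScenarioTree T Node) (n : Node) :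
    tr.stage (tr.parent n) ≤ tr.stage n := by
  by_cases h : n = tr.root
  · rw [h, tr.parent_root]
  · have := tr.parent_stage n h
    omega

lemma onPath_stage (tr : ScenarioTree T Node) {m n : Node} (h : tr.onPath m n) :
    tr.stage m ≤ tr.stage n := by
  obtain ⟨k, rfl⟩ := h
  induction k with
  | zero => simp
  | succ k ih =>
    rw [Function.iterate_succ_apply']
    exact (tr.stage_parent_le _).trans ih

lemma onPath_root (tr : ScenarioTree T Node) {m : Node} (h : tr.onPath m tr.root) :
    m = tr.root := by
  apply tr.root_unique
  have h1 := tr.onPath_stage h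
  have h2 := tr.stage_pos m
  rw [tr.stage_root] at h1
  omega

lemma sum_path_root (tr : ScenarioTree T Node) (x : Node → ℝ) :
    ∑ m ∈ tr.pathSet tr.root, x m = x tr.root := by
  have : tr.pathSet tr.root = {tr.root} := by
    ext m
    simp only [pathSet, Finset.mem_filter, Finset.mem_univ, true_and, Finset.mem_singleton]
    exact ⟨tr.onPath_root, fun h => h ▸ tr.onPath_self _⟩
  rw [this, Finset.sum_singleton]

lemma sum_path_step (tr : ScenarioTree T Node) (x : Node → ℝ) (n : Node) (hn : n ≠ tr.root) :
    ∑ m ∈ tr.pathSet n, x m = x n + ∑ m ∈ tr.pathSet (tr.parent n), x m := by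
  have h1 : tr.pathSet n = insert n (tr.pathSet (tr.parent n)) := by
    ext m
    simp only [pathSet, Finset.mem_filter, Finset.mem_univ, true_and, Finset.mem_insert]
    exact tr.onPath_iff m n
  rw [h1, Finset.sum_insert]
  simp only [pathSet, Finset.mem_filter, Finset.mem_univ, true_and]
  intro h
  have h2 := tr.onPath_stage h
  have h3 := tr.parent_stage n hn
  omega

/-- A stage sum of a function of the parent equals the previous stage sum. -/
lemma sum_stage_parent (tr : ScenarioTree T Node) (X : Node → ℝ) (t : ℕ) (ht : 1 ≤ t)
    (htT : t < T) :
    ∑ m ∈ tr.stageSet (t + 1), tr.prob m * X (tr.parent m) =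
      ∑ n ∈ tr.stageSet t, tr.prob n * X n := by
  have hne : ∀ m, tr.stage m = t + 1 → m ≠ tr.root := by
    rintro m hm rfl
    rw [tr.stage_root] at hm
    omega
  have hmaps : ∀ m ∈ tr.stageSet (t + 1), tr.parent m ∈ tr.stageSet t := by
    intro m hm
    simp only [stageSet, Finset.mem_filter, Finset.mem_univ, true_and] at hm ⊢
    have := tr.parent_stage m (hne m hm)
    omega
  rw [← Finset.sum_fiberwise_of_maps_to hmaps]
  refine Finset.sum_congr rfl fun n hn => ?_
  simp only [stageSet, Finset.mem_filter, Finset.mem_univ, true_and] at hn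
  rw [tr.prob_children n (by omega), Finset.sum_mul]
  refine Finset.sum_congr ?_ ?_
  · ext m
    simp only [stageSet, Finset.mem_filter, Finset.mem_univ, true_and]
    constructor
    · rintro ⟨h1, h2⟩
      exact ⟨hne m h1, h2⟩
    · rintro ⟨h1, h2⟩
      have := tr.parent_stage m h1
      rw [h2] at this
      exact ⟨by omega, h2⟩
  · intro m hm
    simp only [Finset.mem_filter] at hm
    rw [hm.2.2]

lemma sum_prob_aux (tr : ScenarioTree T Node) (x : Node → ℝ) (t : ℕ) (ht : 1 ≤ t) :
    t ≤ T → ∑ n ∈ Finset.univ.filter (fun n => tr.stage n ≤ t), tr.prob n * x n =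
      ∑ n ∈ tr.stageSet t, tr.prob n * ∑ m ∈ tr.pathSet n, x m := by
  induction t, ht using Nat.le_induction with
  | base =>
    intro _
    have h1 : Finset.univ.filter (fun n => tr.stage n ≤ 1) = {tr.root} := by
      ext m
      simp only [Finset.mem_filter, Finset.mem_univ, true_and, Finset.mem_singleton]
      refine ⟨fun h => tr.root_unique m (le_antisymm h (tr.stage_pos m)), ?_⟩
      rintro rfl
      exact tr.stage_root.le
    have h2 : tr.stageSet 1 = {tr.root} := by
      ext m
      simp only [stageSet, Finset.mem_filter, Finset.mem_univ, true_and, Finset.mem_singleton]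
      refine ⟨fun h => tr.root_unique m h, ?_⟩
      rintro rfl
      exact tr.stage_root
    rw [h1, h2, Finset.sum_singleton, Finset.sum_singleton, sum_path_root]
  | succ t ht ih =>
    intro hT
    have h1 : Finset.univ.filter (fun n => tr.stage n ≤ t + 1) =
        Finset.univ.filter (fun n => tr.stage n ≤ t) ∪ tr.stageSet (t + 1) := by
      ext m
      simp only [stageSet, Finset.mem_filter, Finset.mem_univ, true_and, Finset.mem_union]
      omega
    have h2 : Disjoint (Finset.univ.filter (fun n => tr.stage n ≤ t)) (tr.stageSet (t + 1)) := by
      rw [Finset.disjoint_left]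
      intro m
      simp only [stageSet, Finset.mem_filter, Finset.mem_univ, true_and]
      omega
    rw [h1, Finset.sum_union h2, ih (by omega),
      ← tr.sum_stage_parent (fun n => ∑ m ∈ tr.pathSet n, x m) t ht (by omega),
      ← Finset.sum_add_distrib]
    refine Finset.sum_congr rfl fun n hn => ?_
    simp only [stageSet, Finset.mem_filter, Finset.mem_univ, true_and] at hn
    have hne : n ≠ tr.root := by
      rintro rfl
      rw [tr.stage_root] at hn
      omega
    rw [tr.sum_path_step x n hne]
    ring

lemma sum_prob (tr : ScenarioTree T Node) (x : Node → ℝ) :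
    ∑ n, tr.prob n * x n =
      ∑ n ∈ tr.stageSet T, tr.prob n * ∑ m ∈ tr.pathSet n, x m := by
  have hT : 1 ≤ T := tr.stage_root ▸ tr.stage_le tr.root
  rw [← tr.sum_prob_aux x T hT le_rfl]
  refine Finset.sum_congr ?_ fun _ _ => rfl
  ext m
  simp [tr.stage_le m]

/-- Running maximum of demand along the path. -/
def runMax (tr : ScenarioTree T Node) (δ : Node → ℝ) (n : Node) : ℝ :=
  sSup (δ '' {m | tr.onPath m n})

/-- Increments of the running maximum. -/
def incr (tr : ScenarioTree T Node) (δ : Node → ℝ) (n : Node) : ℝ :=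
  if n = tr.root then tr.runMax δ n else tr.runMax δ n - tr.runMax δ (tr.parent n)

lemma le_runMax (tr : ScenarioTree T Node) (δ : Node → ℝ) {m n : Node} (h : tr.onPath m n) :
    δ m ≤ tr.runMax δ n :=
  le_csSup (Set.toFinite _).bddAbove ⟨m, h, rfl⟩

lemma runMax_le (tr : ScenarioTree T Node) (δ : Node → ℝ) (n : Node) (c : ℝ)
    (h : ∀ m, tr.onPath m n → δ m ≤ c) : tr.runMax δ n ≤ c := by
  refine csSup_le (Set.Nonempty.image _ ⟨n, tr.onPath_self n⟩) ?_
  rintro _ ⟨m, hm, rfl⟩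
  exact h m hm

lemma sum_incr (tr : ScenarioTree T Node) (δ : Node → ℝ) (n : Node) :
    ∑ m ∈ tr.pathSet n, tr.incr δ m = tr.runMax δ n := by
  induction hs : tr.stage n using Nat.strong_induction_on generalizing n with
  | _ s ih =>
    by_cases hn : n = tr.root
    · subst hn
      rw [sum_path_root, incr, if_pos rfl]
    · have := tr.parent_stage n hn
      rw [tr.sum_path_step _ n hn, ih _ (by omega) (tr.parent n) rfl, incr, if_neg hn]
      ring

lemma incr_feas (tr : ScenarioTree T Node) (δ : Node → ℝ) (hδ : ∀ n, 0 ≤ δ n) :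
    tr.lpFeas δ (tr.incr δ) := by
  refine ⟨fun n => ?_, fun n => ?_⟩
  · unfold incr
    split_ifs with h
    · exact (hδ n).trans (tr.le_runMax δ (tr.onPath_self n))
    · exact sub_nonneg.2 (tr.runMax_le δ _ _ fun m hm => tr.le_runMax δ (tr.onPath_parent hm))
  · rw [sum_incr]
    exact tr.le_runMax δ (tr.onPath_self n)

lemma runMax_le_sum (tr : ScenarioTree T Node) (δ x : Node → ℝ) (hx : tr.lpFeas δ x) (n : Node) :
    tr.runMax δ n ≤ ∑ m ∈ tr.pathSet n, x m := by
  refine tr.runMax_le δ n _ fun m hm => (hx.2 m).trans ?_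
  refine Finset.sum_le_sum_of_subset_of_nonneg ?_ fun i _ _ => hx.1 i
  intro l
  simp only [pathSet, Finset.mem_filter, Finset.mem_univ, true_and]
  exact fun hl => tr.onPath_trans hl hm

end ScenarioTree
/-- **Proposition 4** (Huang and Ahmed): bounds on the optimal value `v^M` of the
single-resource multi-stage LP: `a_* δ̄ ≤ v^M ≤ a^* δ̄`. -/
theorem vM_bounds
    {T : ℕ} {Node : Type} [Fintype Node] [DecidableEq Node]
    (tr : ScenarioTree T Node)
    (a δ : Node → ℝ) (ha : ∀ n, 0 ≤ a n) (hδ : ∀ n, 0 ≤ δ n) :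
    tr.aMin a * tr.deltaBar δ ≤ tr.vM a δ ∧
    tr.vM a δ ≤ tr.aMax a * tr.deltaBar δ := by
  have hmin : ∀ n, tr.aMin a ≤ a n := fun n =>
    csInf_le (Set.finite_range a).bddBelow ⟨n, rfl⟩
  have hmax : ∀ n, a n ≤ tr.aMax a := fun n =>
    le_csSup (Set.finite_range a).bddAbove ⟨n, rfl⟩
  have hmin0 : 0 ≤ tr.aMin a := by
    refine le_csInf (s := Set.range a) ⟨a tr.root, tr.root, rfl⟩ ?_
    rintro _ ⟨n, rfl⟩
    exact ha n
  have hlow : ∀ x, tr.lpFeas δ x → tr.aMin a * tr.deltaBar δ ≤ tr.lpObj a x := by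
    intro x hx
    calc tr.aMin a * tr.deltaBar δ
        ≤ tr.aMin a * ∑ n ∈ tr.stageSet T, tr.prob n * ∑ m ∈ tr.pathSet n, x m := by
          refine mul_le_mul_of_nonneg_left (Finset.sum_le_sum fun n _ => ?_) hmin0
          exact mul_le_mul_of_nonneg_left (tr.runMax_le_sum δ x hx n) (tr.prob_pos n).le
      _ = ∑ n, tr.aMin a * (tr.prob n * x n) := by rw [← tr.sum_prob, Finset.mul_sum]
      _ ≤ tr.lpObj a x := by
          refine Finset.sum_le_sum fun n _ => ?_
          have h := mul_le_mul_of_nonneg_right (hmin n)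
            (mul_nonneg (tr.prob_pos n).le (hx.1 n))
          linarith
  have hf := tr.incr_feas δ hδ
  constructor
  · refine le_csInf (Set.Nonempty.image _ ⟨tr.incr δ, hf⟩) ?_
    rintro _ ⟨x, hx, rfl⟩
    exact hlow x hx
  · have hbdd : BddBelow (tr.lpObj a '' {x | tr.lpFeas δ x}) := by
      refine ⟨tr.aMin a * tr.deltaBar δ, ?_⟩
      rintro _ ⟨x, hx, rfl⟩
      exact hlow x hx
    refine (csInf_le hbdd ⟨tr.incr δ, hf, rfl⟩).trans ?_
    calc tr.lpObj a (tr.incr δ)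
        ≤ ∑ n, tr.aMax a * (tr.prob n * tr.incr δ n) := by
          refine Finset.sum_le_sum fun n _ => ?_
          have h := mul_le_mul_of_nonneg_right (hmax n)
            (mul_nonneg (tr.prob_pos n).le (hf.1 n))
          linarith
      _ = tr.aMax a * tr.deltaBar δ := by
          rw [← Finset.mul_sum, tr.sum_prob]
          congr 1
          refine Finset.sum_congr rfl fun n _ => ?_
          rw [tr.sum_incr]
          rfl

end
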